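/- Let F be a field, D a subring of F, and X a projective model of F/D. Then every valuation ring V ∈ Zar_F(D) dominates exactly one local ring in X (irredundance), and every local ring in X is dominated by at least one valuation ring in Zar_F(D) (completeness). -/

import Mathlib

/-!
Common definitions: valuation rings of a field, the Zariski--Riemann space
`Zar_F(D)` with its Zariski and patch topologies, domination of local subrings,
residual algebraicity, integral closedness, and projective models of `F/D`.
-/

variable {F : Type*} [Field F]

/-- `x` lies in the maximal ideal (set of nonunits) of the (local) subring `R` of `F`. -/
def MemMaxIdeal (R : Subring F) (x : F) : Prop :=
  ∃ h : x ∈ R, ¬ IsUnit (⟨x, h⟩ : R)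

/-- The local ring `R` dominates the local ring `S` (both subrings of `F`):
`S ⊆ R` and the maximal ideal of `R` contracts to the maximal ideal of `S`. -/
def Dominates (R S : Subring F) : Prop :=
  S ≤ R ∧ ∀ x ∈ S, (MemMaxIdeal S x ↔ MemMaxIdeal R x)

/-- `V` is a valuation ring of the field `F`: for every nonzero `x ∈ F`,
`x ∈ V` or `x⁻¹ ∈ V`. -/
def IsValSubring (V : Subring F) : Prop :=
  ∀ x : F, x ≠ 0 → x ∈ V ∨ x⁻¹ ∈ V

/-- `Zar_F(D)`: the valuation rings of `F` containing `D`. -/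
def zarSet (D : Subring F) : Set (Subring F) :=
  {V | IsValSubring V ∧ D ≤ V}

/-- `Dom_F(D)`: the valuation rings of `F` dominating the local subring `D`. -/
def domSet (D : Subring F) : Set (Subring F) :=
  {V | IsValSubring V ∧ Dominates V D}

/-- The Zariski topology on a collection `X` of subrings of `F`, with basic open sets
`U(x₁,…,xₙ) = {R ∈ X : x₁,…,xₙ ∈ R}`. -/
def zariskiTop (X : Set (Subring F)) : TopologicalSpace X :=
  TopologicalSpace.generateFrom
    {U | ∃ s : Finset F, U = {R : X | ∀ x ∈ s, x ∈ (R : Subring F)}}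

/-- The patch topology on a collection `X` of subrings of `F`: generated by the
quasicompact Zariski-open sets together with their complements. -/
def patchTop (X : Set (Subring F)) : TopologicalSpace X :=
  TopologicalSpace.generateFrom
    ({U | @IsOpen _ (zariskiTop X) U ∧ @IsCompact _ (zariskiTop X) U} ∪
      {V | ∃ U, @IsOpen _ (zariskiTop X) U ∧ @IsCompact _ (zariskiTop X) U ∧ V = Uᶜ})

/-- `R` is residually algebraic over `D`: the residue field extension
`D/m_D → R/m_R` is algebraic, i.e. each element of `R` satisfies, modulo the
maximal ideal of `R`, a monic polynomial with coefficients in `D`. -/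
def ResiduallyAlgebraic (D R : Subring F) : Prop :=
  ∀ x ∈ R, ∃ p : Polynomial F, p.Monic ∧ (∀ i, p.coeff i ∈ D) ∧ MemMaxIdeal R (p.eval x)

/-- `R` is integrally closed in `F`: every element of `F` integral over `R` lies in `R`. -/
def IntegrallyClosedIn (R : Subring F) : Prop :=
  ∀ x : F, (∃ p : Polynomial F, p.Monic ∧ (∀ i, p.coeff i ∈ R) ∧ p.eval x = 0) → x ∈ R

/-- The localization of the subring `A` of `F` at the prime ideal `P`, viewed as the
subring of `F` generated by the fractions `a/b` with `a, b ∈ A`, `b ∉ P`. -/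
def localizationSubring (A : Subring F) (P : Ideal A) : Subring F :=
  Subring.closure {z : F | ∃ a b : A, b ∉ P ∧ z = (a : F) * (b : F)⁻¹}

/-- The ring `D[x₁/xᵢ, …, xₙ/xᵢ]`. -/
def modelChart (D : Subring F) {n : ℕ} (x : Fin n → F) (i : Fin n) : Subring F :=
  Subring.closure ((D : Set F) ∪ {y | ∃ j, y = x j * (x i)⁻¹})

/-- `X` is the projective model of `F/D` defined by some nonzero elements
`x₀, …, xₙ` of `F`: the set of all localizations of the rings
`D[x₀/xᵢ, …, xₙ/xᵢ]` at their prime ideals. -/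
def IsProjModel (D : Subring F) (X : Set (Subring F)) : Prop :=
  ∃ (n : ℕ) (x : Fin (n + 1) → F), (∀ i, x i ≠ 0) ∧
    X = {R | ∃ (i : Fin (n + 1)) (P : Ideal (modelChart D x i)),
          P.IsPrime ∧ R = localizationSubring (modelChart D x i) P}

/-- `X(Z)`: the members of the projective model `X` dominated by some valuation ring
in `Z`. -/
def modelImage (X Z : Set (Subring F)) : Set (Subring F) :=
  {α ∈ X | ∃ V ∈ Z, Dominates V α}

/-- `A(Y)`: the intersection of a collection `Y` of subrings of `F`, as a subset of `F`. -/
def ringsInter (Y : Set (Subring F)) : Set F :=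
  ⋂ R ∈ Y, (R : Set F)

theorem dominates_iff {R S : Subring F} :
    Dominates R S ↔ S ≤ R ∧ ∀ x ∈ S, x⁻¹ ∈ R → x⁻¹ ∈ S := by
  have isUnit_iff (A : Subring F) (x : F) (h : x ∈ A) :
      IsUnit (⟨x, h⟩ : A) ↔ x ≠ 0 ∧ x⁻¹ ∈ A := by
    constructor
    · intro hu
      obtain ⟨⟨y, hy⟩, hxy⟩ := isUnit_iff_exists_inv.mp hu
      have hxy : x * y = 1 := congrArg Subtype.val hxy
      exact ⟨left_ne_zero_of_mul_eq_one hxy, by rwa [← eq_inv_of_mul_eq_one_right hxy]⟩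
    · rintro ⟨h0, hi⟩
      exact isUnit_iff_exists_inv.mpr ⟨⟨x⁻¹, hi⟩, Subtype.ext (mul_inv_cancel₀ h0)⟩
  refine and_congr_right fun hle => forall₂_congr fun x hx => ?_
  have hxR : x ∈ R := hle hx
  have hmono : x⁻¹ ∈ S → x⁻¹ ∈ R := fun h => hle h
  have hzero : x = 0 → x⁻¹ ∈ S := by rintro rfl; simp
  simp only [MemMaxIdeal, isUnit_iff, hx, hxR, exists_true_left]
  tauto

theorem le_localizationSubring (A : Subring F) (P : Ideal A) (hP : P.IsPrime) :
    A ≤ localizationSubring A P := fun a ha =>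
  Subring.subset_closure ⟨⟨a, ha⟩, 1, P.ne_top_iff_one.mp hP.ne_top, by simp⟩

theorem inv_mem_localizationSubring {A : Subring F} {P : Ideal A} {b : A} (hb : b ∉ P) :
    (b : F)⁻¹ ∈ localizationSubring A P :=
  Subring.subset_closure ⟨1, b, hb, by simp⟩

theorem exists_of_mem_ofPrime {A : Subring F} {P : Ideal A} [P.IsPrime] {z : F}
    (hz : z ∈ (LocalSubring.ofPrime A P).toSubring) :
    ∃ a b : A, b ∉ P ∧ z = (a : F) * (b : F)⁻¹ := by
  obtain ⟨⟨a, b⟩, h⟩ := IsLocalization.surj P.primeCompl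
    (⟨z, hz⟩ : (LocalSubring.ofPrime A P).toSubring)
  have hb : (b : A) ∉ P := b.2
  have hb0 : ((b : A) : F) ≠ 0 := fun h0 => hb (by
    rw [show (b : A) = 0 from Subtype.ext h0]; exact P.zero_mem)
  have h : z * ((b : A) : F) = a := congrArg Subtype.val h
  exact ⟨a, b, hb, by rw [← h, mul_inv_cancel_right₀ hb0]⟩

theorem localizationSubring_eq_ofPrime (A : Subring F) (P : Ideal A) [hP : P.IsPrime] :
    localizationSubring A P = (LocalSubring.ofPrime A P).toSubring := by
  apply le_antisymm
  · refine Subring.closure_le.mpr ?_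
    rintro _ ⟨a, b, hb, rfl⟩
    have hu : IsUnit (algebraMap A (LocalSubring.ofPrime A P).toSubring b) :=
      IsLocalization.map_units _ (⟨b, hb⟩ : P.primeCompl)
    obtain ⟨⟨c, hc⟩, hbc⟩ := isUnit_iff_exists_inv.mp hu
    have hbc : (b : F) * c = 1 := congrArg Subtype.val hbc
    rw [← eq_inv_of_mul_eq_one_right hbc]
    exact mul_mem (LocalSubring.le_ofPrime A P a.2) hc
  · intro z hz
    obtain ⟨a, b, hb, rfl⟩ := exists_of_mem_ofPrime hz
    exact Subring.subset_closure ⟨a, b, hb, rfl⟩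

/-- The localization of `A` at a prime is dominated by some valuation ring of `F`. -/
theorem exists_isValSubring_dominates_localizationSubring (A : Subring F) (P : Ideal A)
    [P.IsPrime] : ∃ V, IsValSubring V ∧ Dominates V (localizationSubring A P) := by
  rw [localizationSubring_eq_ofPrime]
  obtain ⟨B, hle, hloc⟩ := (LocalSubring.ofPrime A P).exists_le_valuationSubring
  refine ⟨B.toSubring, fun x _ => B.mem_or_inv_mem x, dominates_iff.mpr ⟨hle, fun x hx hi => ?_⟩⟩
  obtain rfl | hx0 := eq_or_ne x 0
  · simp
  have hu : IsUnit (Subring.inclusion hle ⟨x, hx⟩) :=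
    isUnit_iff_exists_inv.mpr ⟨⟨x⁻¹, hi⟩, Subtype.ext (mul_inv_cancel₀ hx0)⟩
  obtain ⟨⟨y, hy⟩, hxy⟩ := isUnit_iff_exists_inv.mp (hloc.map_nonunit _ hu)
  have hxy : x * y = 1 := congrArg Subtype.val hxy
  rwa [← eq_inv_of_mul_eq_one_right hxy]

/-- A valuation ring of `F`, as a `ValuationSubring`. -/
def IsValSubring.toValuationSubring {V : Subring F} (hV : IsValSubring V) :
    ValuationSubring F where
  toSubring := V
  mem_or_inv_mem' x := by
    by_cases hx : x = 0
    · exact Or.inl (hx ▸ V.zero_mem)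
    · exact hV x hx

/-- A valuation ring containing `A` dominates the localization of `A` at its center. -/
theorem exists_dominates_localizationSubring {V A : Subring F} (hV : IsValSubring V)
    (hA : A ≤ V) : ∃ P : Ideal A, P.IsPrime ∧ Dominates V (localizationSubring A P) := by
  let W : ValuationSubring F := hV.toValuationSubring
  let P : Ideal A := (IsLocalRing.maximalIdeal W).comap (Subring.inclusion hA : A →+* W)
  have hP : P.IsPrime := Ideal.comap_isPrime _ _
  have notMem_iff (b : A) : b ∉ P ↔ (b : F) ≠ 0 ∧ (b : F)⁻¹ ∈ V := by
    have hmem : b ∉ P ↔ IsUnit (Subring.inclusion hA b : W) := by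
      simp only [P, Ideal.mem_comap, IsLocalRing.mem_maximalIdeal, mem_nonunits_iff, not_not]
      exact Iff.rfl
    rw [hmem]
    constructor
    · intro hu
      obtain ⟨⟨y, hy⟩, hxy⟩ := isUnit_iff_exists_inv.mp hu
      have hxy : (b : F) * y = 1 := congrArg Subtype.val hxy
      exact ⟨left_ne_zero_of_mul_eq_one hxy, by
        rw [← eq_inv_of_mul_eq_one_right hxy]; exact hy⟩
    · rintro ⟨h0, hi⟩
      exact isUnit_iff_exists_inv.mpr ⟨⟨(b : F)⁻¹, hi⟩, Subtype.ext (mul_inv_cancel₀ h0)⟩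
  refine ⟨P, hP, dominates_iff.mpr ⟨?_, fun x hx hi => ?_⟩⟩
  · refine Subring.closure_le.mpr ?_
    rintro _ ⟨a, b, hb, rfl⟩
    exact mul_mem (hA a.2) ((notMem_iff b).mp hb).2
  · obtain rfl | hx0 := eq_or_ne x 0
    · simp
    rw [localizationSubring_eq_ofPrime] at hx
    obtain ⟨a, b, hb, rfl⟩ := exists_of_mem_ofPrime hx
    have ha0 : (a : F) ≠ 0 := left_ne_zero_of_mul hx0
    have hb0 := ((notMem_iff b).mp hb).1
    have ha : a ∉ P := by
      refine (notMem_iff a).mpr ⟨ha0, ?_⟩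
      have h : ((a : F) * (b : F)⁻¹)⁻¹ * (b : F)⁻¹ = (a : F)⁻¹ := by field_simp
      rw [← h]
      exact mul_mem hi ((notMem_iff b).mp hb).2
    rw [mul_inv, inv_inv, mul_comm]
    exact mul_mem (le_localizationSubring A P hP b.2) (inv_mem_localizationSubring ha)

theorem le_modelChart (D : Subring F) {n : ℕ} (x : Fin n → F) (i : Fin n) :
    D ≤ modelChart D x i := fun _ hd => Subring.subset_closure (Or.inl hd)

theorem mul_inv_mem_modelChart (D : Subring F) {n : ℕ} (x : Fin n → F) (i j : Fin n) :
    x j * (x i)⁻¹ ∈ modelChart D x i := Subring.subset_closure (Or.inr ⟨j, rfl⟩)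

theorem exists_modelChart_le {D V : Subring F} (hV : V ∈ zarSet D) {n : ℕ}
    (x : Fin (n + 1) → F) : ∃ i, modelChart D x i ≤ V := by
  let W : ValuationSubring F := hV.1.toValuationSubring
  obtain ⟨i, hi⟩ := Finite.exists_max fun i => W.valuation (x i)
  refine ⟨i, Subring.closure_le.mpr (Set.union_subset hV.2 ?_)⟩
  rintro _ ⟨j, rfl⟩
  refine (W.valuation_le_one_iff _).mp ?_
  rw [map_mul, map_inv₀]
  exact mul_inv_le_one_of_le₀ (hi j) zero_le

/-- If `V` dominates local rings of two charts, the first lies in the second. -/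
theorem localizationSubring_le_of_dominates {D V : Subring F} {n : ℕ} {x : Fin n → F}
    (hx : ∀ i, x i ≠ 0) {i j : Fin n} {P : Ideal (modelChart D x i)}
    {Q : Ideal (modelChart D x j)} (hP : P.IsPrime) (hQ : Q.IsPrime)
    (hVP : Dominates V (localizationSubring (modelChart D x i) P))
    (hVQ : Dominates V (localizationSubring (modelChart D x j) Q)) :
    localizationSubring (modelChart D x i) P ≤ localizationSubring (modelChart D x j) Q := by
  rw [dominates_iff] at hVP hVQ
  have hiP := le_localizationSubring _ P hP
  have hjQ := le_localizationSubring _ Q hQ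
  have hinv : x j * (x i)⁻¹ ∈ localizationSubring (modelChart D x j) Q := by
    have h := hVQ.2 _ (hjQ (mul_inv_mem_modelChart D x j i)) (by
      rw [mul_inv, inv_inv, mul_comm]
      exact hVP.1 (hiP (mul_inv_mem_modelChart D x i j)))
    rwa [mul_inv, inv_inv, mul_comm] at h
  have hle : modelChart D x i ≤ localizationSubring (modelChart D x j) Q := by
    refine Subring.closure_le.mpr (Set.union_subset (fun d hd => hjQ (le_modelChart D x j hd)) ?_)
    rintro _ ⟨k, rfl⟩
    have h := mul_mem (hjQ (mul_inv_mem_modelChart D x j k)) hinv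
    rwa [← mul_assoc, inv_mul_cancel_right₀ (hx j)] at h
  refine Subring.closure_le.mpr ?_
  rintro _ ⟨a, b, hb, rfl⟩
  exact mul_mem (hle a.2) (hVQ.2 _ (hle b.2) (hVP.1 (inv_mem_localizationSubring hb)))

/-- Irredundance and completeness of a projective model `X` of `F/D`: every
valuation ring in `Zar_F(D)` dominates exactly one member of `X`, and every member
of `X` is dominated by at least one valuation ring in `Zar_F(D)`. -/
theorem statement2 (D : Subring F) (X : Set (Subring F)) (hX : IsProjModel D X) :
    (∀ V ∈ zarSet D, ∃! α : Subring F, α ∈ X ∧ Dominates V α) ∧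
    (∀ α ∈ X, ∃ V ∈ zarSet D, Dominates V α) := by
  obtain ⟨n, x, hx, rfl⟩ := hX
  refine ⟨fun V hV => ?_, ?_⟩
  · obtain ⟨i, hi⟩ := exists_modelChart_le hV x
    obtain ⟨P, hP, hdom⟩ := exists_dominates_localizationSubring hV.1 hi
    refine ⟨_, ⟨⟨i, P, hP, rfl⟩, hdom⟩, ?_⟩
    rintro _ ⟨⟨j, Q, hQ, rfl⟩, hdom'⟩
    exact le_antisymm (localizationSubring_le_of_dominates hx hQ hP hdom' hdom)
      (localizationSubring_le_of_dominates hx hP hQ hdom hdom')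
  · rintro _ ⟨i, P, hP, rfl⟩
    obtain ⟨V, hV, hdom⟩ := exists_isValSubring_dominates_localizationSubring _ P
    exact ⟨V, ⟨hV, (le_modelChart D x i).trans
      ((le_localizationSubring _ P hP).trans hdom.1)⟩, hdom⟩
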